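/- arXiv:2401.01086 — 2 statements merged into one kernel-verified Lean document; each statement's English description precedes it below -/
import Mathlib

section
/- Let μ and φ be finite positive Borel measures on ℝ^d all of whose moments are finite, and suppose μ satisfies Carleman's condition. Then φ ≤ μ if and only if M_n(φ) ⪯ M_n(μ) for every n ∈ ℕ. -/
open MeasureTheory Finset Filter

noncomputable section

/-- The monomial `x ↦ x^α`. -/
def mono (d : ℕ) (α : Fin d → ℕ) (x : Fin d → ℝ) : ℝ := ∏ i, x i ^ α i

/-- All moments of `μ` are finite. -/
def HasAllMoments {d : ℕ} (μ : Measure (Fin d → ℝ)) : Prop :=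
  ∀ α : Fin d → ℕ, Integrable (mono d α) μ

/-- The moment `μ_α = ∫ x^α dμ`. -/
def mMom {d : ℕ} (μ : Measure (Fin d → ℝ)) (α : Fin d → ℕ) : ℝ := ∫ x, mono d α x ∂μ

instance fintypeIdx (d n : ℕ) : Fintype {α : Fin d → ℕ // ∑ i, α i ≤ n} :=
  Fintype.ofInjective
    (fun a => (fun i => (⟨a.1 i,
        Nat.lt_succ_of_le (le_trans
          (Finset.single_le_sum (fun j _ => Nat.zero_le (a.1 j)) (Finset.mem_univ i)) a.2)⟩ :
        Fin (n+1))) : _ → (Fin d → Fin (n+1)))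
    (fun a b h => by
      apply Subtype.ext
      funext i
      exact congrArg Fin.val (congrFun h i))

/-- Moment matrix of order `n` built from a moment function `m`. -/
def momMat (d n : ℕ) (m : (Fin d → ℕ) → ℝ) :
    Matrix {α : Fin d → ℕ // ∑ i, α i ≤ n} {α : Fin d → ℕ // ∑ i, α i ≤ n} ℝ :=
  fun a b => m (a.1 + b.1)

/-- Carleman's condition. -/
def Carleman {d : ℕ} (μ : Measure (Fin d → ℝ)) : Prop :=
  ∀ i : Fin d, ¬ Summable (fun j : ℕ =>
    (∫ x, x i ^ (2 * (j + 1)) ∂μ) ^ (-(1 : ℝ) / (2 * (j + 1) : ℝ)))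

/-- Positive part of the Hahn–Jordan decomposition of `μ - ν`. -/
def hjPos {d : ℕ} (μ ν : Measure (Fin d → ℝ)) [IsFiniteMeasure μ] [IsFiniteMeasure ν] :
    Measure (Fin d → ℝ) :=
  (μ.toSignedMeasure - ν.toSignedMeasure).toJordanDecomposition.posPart

/-- Negative part of the Hahn–Jordan decomposition of `μ - ν`. -/
def hjNeg {d : ℕ} (μ ν : Measure (Fin d → ℝ)) [IsFiniteMeasure μ] [IsFiniteMeasure ν] :
    Measure (Fin d → ℝ) :=
  (μ.toSignedMeasure - ν.toSignedMeasure).toJordanDecomposition.negPart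

/-- Total variation distance `‖μ - ν‖_TV` (as a real number). -/
def tvReal {d : ℕ} (μ ν : Measure (Fin d → ℝ)) [IsFiniteMeasure μ] [IsFiniteMeasure ν] : ℝ :=
  (hjPos μ ν Set.univ + hjNeg μ ν Set.univ).toReal

/-- Degree-`2n` pseudo-moment vectors. -/
abbrev PV (d n : ℕ) := {α : Fin d → ℕ // ∑ i, α i ≤ 2 * n} → ℝ

/-- Moment matrix of a degree-`2n` pseudo-moment vector. -/
def pvMat (d n : ℕ) (φ : PV d n) :
    Matrix {α : Fin d → ℕ // ∑ i, α i ≤ n} {α : Fin d → ℕ // ∑ i, α i ≤ n} ℝ :=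
  fun a b => φ ⟨a.1 + b.1, by
    have h : ∑ i, (a.1 + b.1) i = (∑ i, a.1 i) + ∑ i, b.1 i := by
      simp [Finset.sum_add_distrib]
    have ha := a.2
    have hb := b.2
    omega⟩

/-- The index `α = 0`. -/
def zeroIdx (d n : ℕ) : {α : Fin d → ℕ // ∑ i, α i ≤ 2 * n} := ⟨0, by simp⟩

/-- Feasibility for the level-`n` semidefinite relaxation. -/
def Feas (d n : ℕ) (μ ν : Measure (Fin d → ℝ)) (φ ψ : PV d n) : Prop :=
  (∀ α, φ α - ψ α = mMom μ α.1 - mMom ν α.1) ∧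
  (pvMat d n φ).PosSemidef ∧ (momMat d n (mMom μ) - pvMat d n φ).PosSemidef ∧
  (pvMat d n ψ).PosSemidef ∧ (momMat d n (mMom ν) - pvMat d n ψ).PosSemidef

/-- Values of the level-`n` semidefinite relaxation. -/
def primalSet (d n : ℕ) (μ ν : Measure (Fin d → ℝ)) : Set ℝ :=
  {r | ∃ φ ψ : PV d n, Feas d n μ ν φ ψ ∧ r = φ (zeroIdx d n) + ψ (zeroIdx d n)}

/-- The optimal value `ρ_n` of the level-`n` semidefinite relaxation. -/
def rho (d n : ℕ) (μ ν : Measure (Fin d → ℝ)) : ℝ := sInf (primalSet d n μ ν)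


/-- qualitative Carleman inequality -/
theorem carleman_ineq (a : ℕ → ℝ) (ha : ∀ k, 0 < a k) (hs : Summable a) :
    Summable (fun n : ℕ => (∏ k ∈ range (n+1), a k) ^ ((1:ℝ) / (n+1))) := by
  set S : ℕ → ℝ := fun m => ∑ k ∈ range m, ((k:ℝ)+1) * a k with hS
  have hS0 : ∀ m, 0 ≤ S m := fun m => sum_nonneg fun k _ => by have := ha k; positivity
  have key : ∀ m : ℕ, ∑ n ∈ range m, S (n+1) / ((n:ℝ)+1)^2 + 2 / (2*(m:ℝ)+1) * S m
      ≤ ∑ k ∈ range m, 2 / (2*(k:ℝ)+1) * ((k+1) * a k) := by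
    intro m
    induction m with
    | zero => simp [hS]
    | succ m ih =>
      rw [sum_range_succ, sum_range_succ (fun k : ℕ => 2 / (2*(k:ℝ)+1) * ((k+1) * a k))]
      have h1 : S (m+1) = S m + ((m:ℝ)+1) * a m := by simp [hS, sum_range_succ]
      have h2 : 1 / ((m:ℝ)+1)^2 + 2 / (2*((m+1 : ℕ):ℝ)+1) ≤ 2 / (2*(m:ℝ)+1) := by
        push_cast
        rw [div_add_div _ _ (by positivity) (by positivity), div_le_div_iff₀ (by positivity) (by positivity)]
        nlinarith [(Nat.cast_nonneg m : (0:ℝ) ≤ m)]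
      have h3 := mul_le_mul_of_nonneg_right h2 (hS0 (m+1))
      have h4 : S (m+1) / ((m:ℝ)+1)^2 = 1 / ((m:ℝ)+1)^2 * S (m+1) := by ring
      have h5 : 2 / (2*(m:ℝ)+1) * S (m+1) = 2 / (2*(m:ℝ)+1) * S m + 2 / (2*(m:ℝ)+1) * ((m+1) * a m) := by
        rw [h1]; ring
      rw [h4]
      linarith
  have sumS : Summable (fun n : ℕ => S (n+1) / ((n:ℝ)+1)^2) := by
    refine summable_of_sum_range_le (c := 2 * ∑' k, a k) (fun n => div_nonneg (hS0 _) (by positivity)) ?_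
    intro m
    have h1 := key m
    have h2 : 0 ≤ 2 / (2*(m:ℝ)+1) * S m := mul_nonneg (by positivity) (hS0 m)
    have h3 : ∑ k ∈ range m, 2 / (2*(k:ℝ)+1) * ((k+1) * a k) ≤ ∑ k ∈ range m, 2 * a k := by
      refine sum_le_sum fun k _ => ?_
      rw [← mul_assoc]
      refine mul_le_mul_of_nonneg_right ?_ (ha k).le
      rw [div_mul_eq_mul_div, div_le_iff₀ (by positivity)]
      nlinarith [(Nat.cast_nonneg k : (0:ℝ) ≤ k)]
    have h4 : ∑ k ∈ range m, 2 * a k ≤ 2 * ∑' k, a k := by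
      rw [← mul_sum]
      exact mul_le_mul_of_nonneg_left (hs.sum_le_tsum _ fun k _ => (ha k).le) (by norm_num)
    linarith
  refine Summable.of_nonneg_of_le (fun n => Real.rpow_nonneg (prod_nonneg fun k _ => (ha k).le) _) ?_
    (sumS.mul_left (Real.exp 1))
  intro n
  have hN : (0:ℝ) < n + 1 := by positivity
  -- AM-GM
  have amgm := Real.geom_mean_le_arith_mean_weighted (range (n+1)) (fun _ => (1:ℝ)/(n+1))
    (fun k => ((k:ℝ)+1) * a k) (fun _ _ => by positivity) (by simp; field_simp)
    (fun k _ => by have := ha k; positivity)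
  rw [Real.finsetProd_rpow _ _ (fun k _ => by have := ha k; positivity), ← mul_sum, prod_mul_distrib] at amgm
  have hf : (∏ k ∈ range (n+1), ((k:ℝ)+1)) = ((n+1).factorial : ℝ) := by
    rw [← prod_range_add_one_eq_factorial]; push_cast; rfl
  have hP : 0 ≤ ∏ k ∈ range (n+1), a k := prod_nonneg fun k _ => (ha k).le
  rw [hf, Real.mul_rpow (by positivity) hP] at amgm
  have hfac : ((n:ℝ)+1) / Real.exp 1 ≤ ((n+1).factorial : ℝ) ^ ((1:ℝ)/(n+1)) := by
    have h := Real.pow_div_factorial_le_exp (x := (n:ℝ)+1) (by positivity) (n+1)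
    rw [div_le_iff₀ (by positivity)] at h
    have h2 : (((n:ℝ)+1) / Real.exp 1)^(n+1) ≤ ((n+1).factorial : ℝ) := by
      rw [div_pow, div_le_iff₀ (by positivity), ← Real.exp_nat_mul]
      push_cast
      rw [mul_one]; linarith
    have h3 := Real.rpow_le_rpow (by positivity) h2 (z := (1:ℝ)/(n+1)) (by positivity)
    rw [← Real.rpow_natCast, ← Real.rpow_mul (by positivity)] at h3
    have : (((n+1:ℕ):ℝ)) * ((1:ℝ)/(n+1)) = 1 := by push_cast; field_simp
    rwa [this, Real.rpow_one] at h3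
  have h6 : ((n:ℝ)+1) / Real.exp 1 * (∏ k ∈ range (n+1), a k) ^ ((1:ℝ)/(n+1)) ≤ 1 / ((n:ℝ)+1) * S (n+1) :=
    le_trans (mul_le_mul_of_nonneg_right hfac (Real.rpow_nonneg hP _)) amgm
  have he := Real.exp_pos 1
  have : (∏ k ∈ range (n+1), a k) ^ ((1:ℝ)/(n+1)) = Real.exp 1 / (n+1) * (((n:ℝ)+1) / Real.exp 1 * (∏ k ∈ range (n+1), a k) ^ ((1:ℝ)/(n+1))) := by
    field_simp
  rw [this]
  refine (mul_le_mul_of_nonneg_left h6 (by positivity)).trans (le_of_eq ?_)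
  field_simp

/-- Bang's argument. -/
theorem bang (f : ℕ → ℝ → ℂ) (M : ℕ → ℝ) (hM : ∀ n, 0 < M n)
    (hlc : ∀ n, M (n+1) ^ 2 ≤ M n * M (n+2))
    (hb : ∀ n s, ‖f n s‖ ≤ M n)
    (htay : ∀ n m s u, 0 ≤ u → ‖f n (s+u)‖ ≤
      ∑ j ∈ range m, ‖f (n+j) s‖ * (u^j / (j.factorial : ℝ)) + M (n+m) * (u^m / (m.factorial : ℝ)))
    (h0 : ∀ n, f n 0 = 0) (hns : ¬ Summable (fun n => M n / M (n+1))) :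
    ∀ s, 0 ≤ s → f 0 s = 0 := by
  set r : ℕ → ℝ := fun k => M (k+1) / M k with hr
  have hrpos : ∀ k, 0 < r k := fun k => div_pos (hM _) (hM _)
  have hrmono : Monotone r := by
    refine monotone_nat_of_le_succ fun k => ?_
    simp only [hr]
    rw [div_le_div_iff₀ (hM _) (hM _)]
    have := hlc k
    nlinarith
  have hMr : ∀ K n j, n + j ≤ K + 1 → M (n+j) ≤ M n * r K ^ j := by
    intro K n j
    induction j with
    | zero => simp
    | succ j ih =>
      intro h
      have h1 := ih (by omega)
      have h2 : M (n+(j+1)) = M (n+j) * r (n+j) := by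
        simp only [hr]; rw [mul_div_cancel₀ _ (hM _).ne']; rfl
      have h3 : r (n+j) ≤ r K := hrmono (by omega)
      rw [h2, pow_succ, ← mul_assoc]
      exact mul_le_mul h1 h3 (hrpos _).le (mul_nonneg (hM _).le (pow_nonneg (hrpos _).le _))
  have step : ∀ (K : ℕ) (s u : ℝ), (∀ n, ‖f n s‖ ≤ Real.exp (-((K:ℝ)+1)) * (Real.exp 1 ^ n * M n)) → 0 ≤ u →
      u ≤ 1 / (Real.exp 1 * r K) → ∀ n, ‖f n (s+u)‖ ≤ Real.exp (-(K:ℝ)) * (Real.exp 1 ^ n * M n) := by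
    intro K s u hP hu hu2 n
    have hE := Real.exp_pos 1
    by_cases hn : K + 1 ≤ n
    · refine (hb n _).trans ?_
      have : 1 ≤ Real.exp (-(K:ℝ)) * Real.exp 1 ^ n := by
        rw [← Real.exp_nat_mul, ← Real.exp_add]
        apply Real.one_le_exp
        have : ((K:ℝ)+1) ≤ n := by exact_mod_cast hn
        linarith
      rw [← mul_assoc]
      exact le_mul_of_one_le_left (hM n).le this
    · push Not at hn
      obtain ⟨m, hm⟩ : ∃ m, n + m = K + 1 := ⟨K+1-n, by omega⟩
      have ht := htay n m s u hu
      set b := Real.exp (-((K:ℝ)+1)) with hbdef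
      have hbpos : 0 < b := Real.exp_pos _
      set y := Real.exp 1 * r K * u with hy
      have hy0 : 0 ≤ y := by have := hrpos K; positivity
      have hy1 : y ≤ 1 := by
        rw [le_div_iff₀ (by have := hrpos K; positivity)] at hu2
        rw [hy]; linarith
      have term : ∀ j, n + j ≤ K + 1 → b * (Real.exp 1 ^ (n+j) * M (n+j)) * (u^j / (j.factorial : ℝ))
          ≤ b * (Real.exp 1 ^ n * M n) * (y^j / (j.factorial:ℝ)) := by
        intro j hj
        have h1 := hMr K n j hj
        have : b * (Real.exp 1 ^ n * M n) * (y^j / (j.factorial:ℝ)) =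
          b * (Real.exp 1 ^ (n+j) * (M n * r K ^ j)) * (u^j / (j.factorial : ℝ)) := by
          rw [hy, mul_pow, mul_pow, pow_add]; ring
        rw [this]
        gcongr
      have hlast : M (n+m) ≤ b * (Real.exp 1 ^ (n+m) * M (n+m)) := by
        have : b * Real.exp 1 ^ (n+m) = 1 := by
          rw [hbdef, ← Real.exp_nat_mul, ← Real.exp_add, hm]
          push_cast; simp
        rw [← mul_assoc, this, one_mul]
      have h2 : ∑ j ∈ range m, ‖f (n+j) s‖ * (u^j / (j.factorial : ℝ)) + M (n+m) * (u^m / (m.factorial : ℝ))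
          ≤ ∑ j ∈ range (m+1), b * (Real.exp 1 ^ n * M n) * (y^j / (j.factorial:ℝ)) := by
        rw [sum_range_succ]
        refine add_le_add (sum_le_sum fun j hj => ?_) ?_
        · refine le_trans ?_ (term j (by have := mem_range.1 hj; omega))
          exact mul_le_mul_of_nonneg_right (hP _) (by positivity)
        · refine le_trans ?_ (term m (by omega))
          exact mul_le_mul_of_nonneg_right hlast (by positivity)
      refine (ht.trans h2).trans ?_
      rw [← mul_sum]
      have h3 : ∑ j ∈ range (m+1), y^j / (j.factorial:ℝ) ≤ Real.exp 1 :=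
        (Real.sum_le_exp_of_nonneg hy0 _).trans (Real.exp_le_exp.2 hy1)
      have h4 : Real.exp (-(K:ℝ)) = b * Real.exp 1 := by
        rw [hbdef, ← Real.exp_add]; congr 1; ring
      rw [h4]
      have hMn := hM n
      calc _ ≤ b * (Real.exp 1 ^ n * M n) * Real.exp 1 := by gcongr
        _ = _ := by ring
  have claim : ∀ (m k : ℕ) (s : ℝ), 0 ≤ s → s ≤ ∑ j ∈ range m, 1 / (Real.exp 1 * r (k+j)) →
      ∀ n, ‖f n s‖ ≤ Real.exp (-(k:ℝ)) * (Real.exp 1 ^ n * M n) := by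
    intro m
    induction m with
    | zero =>
      intro k s hs hs2 n
      have : s = 0 := le_antisymm (by simpa using hs2) hs
      subst this
      rw [h0]; have := hM n; simp; positivity
    | succ m ih =>
      intro k s hs hs2
      rw [sum_range_succ'] at hs2
      simp only [add_zero] at hs2
      have hpos : 0 ≤ 1 / (Real.exp 1 * r k) := by have := hrpos k; positivity
      set u := min s (1 / (Real.exp 1 * r k)) with hu
      have hu0 : 0 ≤ u := le_min hs hpos
      have := step k (s-u) u ?_ hu0 (min_le_right _ _)
      · simpa using this
      · have := ih (k+1) (s-u) (by rw [sub_nonneg]; exact min_le_left _ _) ?_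
        · push_cast at this; exact this
        · have e : ∀ j, k + 1 + j = k + (j + 1) := fun j => by ring
          simp only [e]
          rcases min_choice s (1 / (Real.exp 1 * r k)) with h | h
          · rw [hu, h, sub_self]
            exact sum_nonneg fun j _ => by have := hrpos (k+(j+1)); positivity
          · rw [hu, h]; linarith
  intro s hs
  have hall : ∀ k : ℕ, ‖f 0 s‖ ≤ Real.exp (-(k:ℝ)) * M 0 := by
    intro k
    have hns' : ¬ Summable (fun j => 1 / (Real.exp 1 * r (k+j))) := by
      intro h
      apply hns
      have h2 : Summable (fun j => 1 / (Real.exp 1 * r (j))) := by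
        have e : (fun j => 1 / (Real.exp 1 * r (k+j))) = fun j => (fun j => 1 / (Real.exp 1 * r (j))) (j+k) := by
          funext j; simp [add_comm]
        rw [e] at h
        exact (summable_nat_add_iff k).1 h
      have h3 := h2.mul_left (Real.exp 1)
      refine h3.congr fun j => ?_
      simp only [hr]
      have := (hM j).ne'; have := (hM (j+1)).ne'
      field_simp
    have htop := (not_summable_iff_tendsto_nat_atTop_of_nonneg
      (fun j => by have := hrpos (k+j); positivity)).1 hns'
    obtain ⟨m, hm⟩ := (htop.eventually_ge_atTop s).exists
    simpa using claim m k s hs hm 0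
  have hlim : Tendsto (fun k : ℕ => Real.exp (-(k:ℝ)) * M 0) atTop (nhds (0 * M 0)) :=
    (Real.tendsto_exp_neg_atTop_nhds_zero.comp tendsto_natCast_atTop_atTop).mul_const _
  rw [zero_mul] at hlim
  have := ge_of_tendsto' hlim hall
  simpa using this

/-- Taylor bound for `exp(iy)` -/
theorem exp_taylor (m : ℕ) : ∀ y : ℝ, 0 ≤ y → ‖Complex.exp (Complex.I * y) - ∑ j ∈ range m, (Complex.I * y)^j / (j.factorial : ℂ)‖
    ≤ y ^ m / (m.factorial : ℝ) := by
  induction m with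
  | zero => intro y _; simp [mul_comm Complex.I, Complex.norm_exp_ofReal_mul_I]
  | succ m ih =>
    intro y hy
    have hder : ∀ x : ℝ, HasDerivAt (fun y : ℝ => Complex.exp (Complex.I * y) - ∑ j ∈ range (m+1), (Complex.I * y)^j / (j.factorial : ℂ))
        (Complex.I * (Complex.exp (Complex.I * x) - ∑ j ∈ range m, (Complex.I * x)^j / (j.factorial : ℂ))) x := by
      intro x
      have hl : HasDerivAt (fun y : ℝ => Complex.I * (y:ℂ)) Complex.I x := by
        simpa using (Complex.ofRealCLM.hasDerivAt (x := x)).const_mul Complex.I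
      have h1 := hl.cexp
      have h2 : HasDerivAt (fun y : ℝ => ∑ j ∈ range (m+1), (Complex.I * y)^j / (j.factorial : ℂ))
          (∑ j ∈ range (m+1), ((j:ℂ) * (Complex.I * x)^(j-1) * Complex.I) / (j.factorial : ℂ)) x := by
        apply HasDerivAt.fun_sum
        intro j _
        exact (hl.fun_pow j).div_const _
      refine (h1.sub h2).congr_deriv ?_
      symm
      rw [sum_range_succ', mul_sub, mul_sum]
      simp only [Nat.cast_zero, zero_mul, zero_div, add_zero, Nat.add_sub_cancel]
      congr 1
      · ring
      · refine sum_congr rfl fun j _ => ?_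
        rw [Nat.factorial_succ]; push_cast
        have : (j:ℂ) + 1 ≠ 0 := by exact_mod_cast Nat.succ_ne_zero j
        have : (j.factorial:ℂ) ≠ 0 := by exact_mod_cast Nat.factorial_ne_zero j
        field_simp
    have hB : ∀ x : ℝ, HasDerivAt (fun y : ℝ => y^(m+1) / ((m+1).factorial : ℝ)) (x^m / (m.factorial : ℝ)) x := by
      intro x
      refine ((hasDerivAt_pow (m+1) x).div_const ((m+1).factorial : ℝ)).congr_deriv ?_
      rw [Nat.factorial_succ]; push_cast
      have : (m:ℝ) + 1 ≠ 0 := by positivity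
      field_simp
    have := image_norm_le_of_norm_deriv_right_le_deriv_boundary (a := 0) (b := y)
      (f := fun y : ℝ => Complex.exp (Complex.I * y) - ∑ j ∈ range (m+1), (Complex.I * y)^j / (j.factorial : ℂ))
      (f' := fun x : ℝ => (Complex.I * (Complex.exp (Complex.I * x) - ∑ j ∈ range m, (Complex.I * x)^j / (j.factorial : ℂ))))
      (B := fun y : ℝ => y^(m+1) / ((m+1).factorial : ℝ)) (B' := fun x => x^m / (m.factorial : ℝ))
      (fun x _ => (hder x).continuousAt.continuousWithinAt) (fun x _ => (hder x).hasDerivWithinAt)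
      (by simp [sum_range_succ']) hB
      (fun x hx => by rw [norm_mul, Complex.norm_I, one_mul]; exact ih x hx.1)
    exact this ⟨hy, le_rfl⟩

theorem exp_taylor_abs (m : ℕ) (y : ℝ) : ‖Complex.exp (Complex.I * y) - ∑ j ∈ range m, (Complex.I * y)^j / (j.factorial : ℂ)‖
    ≤ |y| ^ m / (m.factorial : ℝ) := by
  rcases le_total 0 y with h | h
  · rw [abs_of_nonneg h]; exact exp_taylor m y h
  · rw [abs_of_nonpos h]
    have := exp_taylor m (-y) (by linarith)
    rw [← Complex.norm_conj] at this
    refine le_trans (le_of_eq ?_) this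
    simp [map_sub, map_sum, ← Complex.exp_conj]
theorem quasi_core {X : Type*} [MeasurableSpace X] (σ : Measure X) (y : X → ℝ) (hy : Measurable y)
    (h : X → ℂ) (hh : AEStronglyMeasurable h σ)
    (hint : ∀ n : ℕ, Integrable (fun x => |y x| ^ n * ‖h x‖) σ)
    (M : ℕ → ℝ) (hM : ∀ n, 0 < M n) (hlc : ∀ n, M (n+1) ^ 2 ≤ M n * M (n+2))
    (hMb : ∀ n, ∫ x, |y x| ^ n * ‖h x‖ ∂σ ≤ M n)
    (hns : ¬ Summable (fun n => M n / M (n+1)))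
    (h0 : ∀ n : ℕ, ∫ x, (y x : ℂ) ^ n * h x ∂σ = 0) (s : ℝ) :
    ∫ x, Complex.exp (Complex.I * (s * y x : ℝ)) * h x ∂σ = 0 := by
  set F : ℕ → ℝ → ℂ := fun n s => ∫ x, (Complex.I * y x) ^ n * Complex.exp (Complex.I * (s * y x : ℝ)) * h x ∂σ with hF
  have hyc : Measurable (fun x => (y x : ℂ)) := Complex.measurable_ofReal.comp hy
  have hE : ∀ s : ℝ, Measurable (fun x => Complex.exp (Complex.I * (s * y x : ℝ))) := fun s => by fun_prop
  have hnE : ∀ (s : ℝ) x, ‖Complex.exp (Complex.I * (s * y x : ℝ))‖ = 1 := fun s x => by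
    rw [mul_comm, Complex.norm_exp_ofReal_mul_I]
  have hnorm : ∀ n s x, ‖(Complex.I * y x) ^ n * Complex.exp (Complex.I * (s * y x : ℝ)) * h x‖ = |y x| ^ n * ‖h x‖ := by
    intro n s x
    rw [norm_mul, norm_mul, hnE]; simp
  have hFi : ∀ n s, Integrable (fun x => (Complex.I * y x) ^ n * Complex.exp (Complex.I * (s * y x : ℝ)) * h x) σ := by
    intro n s
    refine (hint n).mono' ?_ (Eventually.of_forall fun x => (hnorm n s x).le)
    exact (((hyc.const_mul Complex.I).pow_const n).mul (hE s)).aestronglyMeasurable.mul hh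
  have hFb : ∀ n s, ‖F n s‖ ≤ M n := by
    intro n s
    refine (norm_integral_le_integral_norm _).trans ?_
    simp only [hnorm]; exact hMb n
  have hF0 : ∀ n, F n 0 = 0 := by
    intro n
    have : ∀ x, (Complex.I * y x) ^ n * Complex.exp (Complex.I * ((0:ℝ) * y x : ℝ)) * h x = Complex.I ^ n * ((y x : ℂ) ^ n * h x) := by
      intro x; simp [mul_pow, mul_assoc]
    simp only [hF, this]
    rw [integral_const_mul, h0, mul_zero]
  have htay : ∀ n m s u, ‖F n (s+u)‖ ≤
      ∑ j ∈ range m, ‖F (n+j) s‖ * (|u|^j / (j.factorial : ℝ)) + M (n+m) * (|u|^m / (m.factorial : ℝ)) := by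
    intro n m s u
    set G : X → ℂ := fun x => (Complex.I * y x) ^ n * Complex.exp (Complex.I * (s * y x : ℝ)) * h x with hG
    have e1 : ∑ j ∈ range m, ((u:ℂ)^j / (j.factorial : ℂ)) * F (n+j) s =
        ∫ x, (∑ j ∈ range m, (Complex.I * (u * y x : ℝ))^j / (j.factorial : ℂ)) * G x ∂σ := by
      simp only [hF, ← integral_const_mul]
      rw [← integral_finsetSum _ (fun j _ => (hFi (n+j) s).const_mul _)]
      refine integral_congr_ae (Eventually.of_forall fun x => ?_)
      simp only [sum_mul, hG]
      refine sum_congr rfl fun j _ => ?_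
      push_cast
      ring
    have e2 : F n (s+u) = ∫ x, Complex.exp (Complex.I * (u * y x : ℝ)) * G x ∂σ := by
      simp only [hF, hG]
      refine integral_congr_ae (Eventually.of_forall fun x => ?_)
      have : Complex.exp (Complex.I * ((s+u) * y x : ℝ)) = Complex.exp (Complex.I * (s * y x : ℝ)) * Complex.exp (Complex.I * (u * y x : ℝ)) := by
        rw [← Complex.exp_add]; congr 1; push_cast; ring
      simp only [this]; ring
    have i1 : Integrable (fun x => (∑ j ∈ range m, (Complex.I * (u * y x : ℝ))^j / (j.factorial : ℂ)) * G x) σ := by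
      have := integrable_finsetSum (range m) (fun j _ => (hFi (n+j) s).const_mul ((u:ℂ)^j / (j.factorial : ℂ)))
      refine this.congr (Eventually.of_forall fun x => ?_)
      simp only [sum_mul, hG]
      refine sum_congr rfl fun j _ => ?_
      push_cast
      ring
    have i2 : Integrable (fun x => Complex.exp (Complex.I * (u * y x : ℝ)) * G x) σ := by
      refine (hFi n (s+u)).congr (Eventually.of_forall fun x => ?_)
      have : Complex.exp (Complex.I * ((s+u) * y x : ℝ)) = Complex.exp (Complex.I * (s * y x : ℝ)) * Complex.exp (Complex.I * (u * y x : ℝ)) := by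
        rw [← Complex.exp_add]; congr 1; push_cast; ring
      simp only [this, hG]; ring
    have e3 : F n (s+u) = ∑ j ∈ range m, ((u:ℂ)^j / (j.factorial : ℂ)) * F (n+j) s + (F n (s+u) - ∑ j ∈ range m, ((u:ℂ)^j / (j.factorial : ℂ)) * F (n+j) s) := by ring
    rw [e3]
    refine (norm_add_le _ _).trans (add_le_add ?_ ?_)
    · refine (norm_sum_le _ _).trans (le_of_eq (sum_congr rfl fun j _ => ?_))
      rw [norm_mul, mul_comm]; simp
    · rw [e1, e2, ← integral_sub i2 i1]
      refine (norm_integral_le_integral_norm _).trans ?_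
      have : ∀ x, ‖Complex.exp (Complex.I * (u * y x : ℝ)) * G x - (∑ j ∈ range m, (Complex.I * (u * y x : ℝ))^j / (j.factorial : ℂ)) * G x‖
          ≤ (|u|^m / (m.factorial : ℝ)) * (|y x| ^ (n+m) * ‖h x‖) := by
        intro x
        rw [← sub_mul, norm_mul, hnorm n s x]
        refine (mul_le_mul_of_nonneg_right (exp_taylor_abs m (u * y x)) (by positivity)).trans (le_of_eq ?_)
        rw [abs_mul]; ring
      refine (integral_mono (i2.sub i1).norm ((hint (n+m)).const_mul _) this).trans ?_
      rw [integral_const_mul, mul_comm]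
      exact mul_le_mul_of_nonneg_right (hMb _) (by positivity)
  have hpos : ∀ s, 0 ≤ s → F 0 s = 0 := bang F M hM hlc hFb
    (fun n m s u hu => by have := htay n m s u; rwa [abs_of_nonneg hu] at this) hF0 hns
  have hneg : ∀ s, 0 ≤ s → F 0 (-s) = 0 := bang (fun n s => F n (-s)) M hM hlc (fun n s => hFb n (-s))
    (fun n m s u hu => by
      have := htay n m (-s) (-u)
      rw [abs_neg, abs_of_nonneg hu] at this
      rw [neg_add]; exact this) (fun n => by simpa using hF0 n) hns
  have : F 0 s = 0 := by
    rcases le_total 0 s with hs | hs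
    · exact hpos s hs
    · simpa using hneg (-s) (by linarith)
  simpa [hF] using this

theorem cs_sq {X : Type*} [MeasurableSpace X] (σ : Measure X) (u v : X → ℝ)
    (hu : AEStronglyMeasurable u σ) (hv : AEStronglyMeasurable v σ)
    (hu2 : Integrable (fun x => u x ^ 2) σ) (hv2 : Integrable (fun x => v x ^ 2) σ) :
    Integrable (fun x => u x * v x) σ ∧ (∫ x, |u x| * |v x| ∂σ) ^ 2 ≤ (∫ x, u x ^ 2 ∂σ) * ∫ x, v x ^ 2 ∂σ := by
  have mu : MemLp u 2 σ := (memLp_two_iff_integrable_sq hu).2 hu2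
  have mv : MemLp v 2 σ := (memLp_two_iff_integrable_sq hv).2 hv2
  refine ⟨mu.integrable_mul mv, ?_⟩
  have := integral_mul_le_Lp_mul_Lq_of_nonneg (μ := σ) (p := 2) (q := 2) Real.HolderConjugate.two_two
    (f := fun x => |u x|) (g := fun x => |v x|) (Eventually.of_forall fun x => abs_nonneg _)
    (Eventually.of_forall fun x => abs_nonneg _) (by simpa using mu.norm) (by simpa using mv.norm)
  simp only [Real.rpow_two, sq_abs, ← Real.sqrt_eq_rpow] at this
  have h0 : 0 ≤ ∫ x, |u x| * |v x| ∂σ := integral_nonneg fun x => by positivity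
  calc _ ≤ (√(∫ x, u x ^ 2 ∂σ) * √(∫ x, v x ^ 2 ∂σ)) ^ 2 := pow_le_pow_left₀ h0 this 2
    _ = _ := by
      rw [mul_pow, Real.sq_sqrt (integral_nonneg fun x => sq_nonneg _), Real.sq_sqrt (integral_nonneg fun x => sq_nonneg _)]

/-- From Carleman divergence to ratio divergence. -/
theorem ratio_div (s m : ℕ → ℝ) (C : ℝ) (hC : 0 < C) (hs : ∀ n, 0 < s n)
    (hlc : ∀ n, s (n+1) ^ 2 ≤ s n * s (n+2)) (hm : ∀ n, s n ≤ 2 * m n)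
    (hdiv : ¬ Summable (fun j : ℕ => (m (j+1)) ^ (-(1 : ℝ) / (2 * (j + 1) : ℝ)))) :
    ¬ Summable (fun n => √√(C * s (2*n)) / √√(C * s (2*(n+1)))) := by
  intro hsum
  apply hdiv
  set b : ℕ → ℝ := fun k => s k / s (k+1) with hb
  have hbpos : ∀ k, 0 < b k := fun k => div_pos (hs _) (hs _)
  have hbanti : Antitone b := by
    refine antitone_nat_of_succ_le fun k => ?_
    simp only [hb]
    rw [div_le_div_iff₀ (hs _) (hs _)]
    have := hlc k
    nlinarith
  have h1 : Summable (fun n => √(b (2*n+1))) := by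
    refine Summable.of_nonneg_of_le (fun n => Real.sqrt_nonneg _) (fun n => ?_) hsum
    rw [← Real.sqrt_div (Real.sqrt_nonneg _), ← Real.sqrt_div (by have := hs (2*n); positivity), mul_div_mul_left _ _ hC.ne']
    apply Real.sqrt_le_sqrt
    apply Real.le_sqrt_of_sq_le
    have : s (2*n) / s (2*(n+1)) = b (2*n) * b (2*n+1) := by
      simp only [hb]
      have := (hs (2*n+1)).ne'
      have := (hs (2*n+1+1)).ne'
      rw [show 2*(n+1) = 2*n+1+1 by ring]
      field_simp
    rw [this, sq]
    exact mul_le_mul_of_nonneg_right (hbanti (by omega)) (hbpos _).le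
  have h2 : Summable (fun n => √(b n)) := by
    rw [← summable_nat_add_iff 1]
    refine Summable.even_add_odd ?_ ?_
    · exact h1
    · refine Summable.of_nonneg_of_le (fun n => Real.sqrt_nonneg _) (fun n => ?_) h1
      exact Real.sqrt_le_sqrt (hbanti (by omega))
  have h3 := carleman_ineq _ (fun k => Real.sqrt_pos.2 (hbpos k)) h2
  have hprod : ∀ n, ∏ k ∈ range n, √(b k) = √(s 0 / s n) := by
    intro n
    induction n with
    | zero => simp [div_self (hs 0).ne']
    | succ n ih =>
      rw [prod_range_succ, ih, ← Real.sqrt_mul (div_pos (hs _) (hs _)).le]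
      congr 1
      simp only [hb]
      have := (hs n).ne'
      have := (hs (n+1)).ne'
      field_simp
  have h4 := h3.mul_left (1 + 2 / s 0)
  have hs0 := hs 0
  have hmpos : ∀ n, 0 < m n := fun n => by have := hs n; have := hm n; linarith
  refine Summable.of_nonneg_of_le (fun n => Real.rpow_nonneg (hmpos _).le _) (fun n => ?_) h4
  have hsn := hs (n+1)
  have hmn := hmpos (n+1)
  rw [hprod, Real.sqrt_eq_rpow, ← Real.rpow_mul (by positivity)]
  have ep : (1:ℝ)/2 * (1 / ((n:ℝ)+1)) = 1 / (2 * ((n:ℝ)+1)) := by field_simp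
  have en : -(1:ℝ) / (2 * ((n:ℝ)+1)) = -(1 / (2 * ((n:ℝ)+1))) := by ring
  rw [ep, en]
  set p := 1 / (2 * ((n:ℝ)+1)) with hp
  have hp0 : 0 ≤ p := by positivity
  have hp1 : p ≤ 1 := by
    rw [hp, div_le_one (by positivity)]
    have : (0:ℝ) ≤ n := Nat.cast_nonneg n
    linarith
  rw [Real.rpow_neg hmn.le, ← Real.inv_rpow hmn.le]
  have k1 : (m (n+1))⁻¹ ≤ (1 + 2 / s 0) * (s 0 / s (n+1)) := by
    have e : (2 / s 0) * (s 0 / s (n+1)) = 2 / s (n+1) := by field_simp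
    have e2 : (m (n+1))⁻¹ ≤ 2 / s (n+1) := by
      rw [inv_le_iff_one_le_mul₀ hmn, div_mul_eq_mul_div, one_le_div hsn]
      exact hm _
    have : 0 < s 0 / s (n+1) := by positivity
    rw [add_mul, e]; linarith
  calc _ ≤ ((1 + 2 / s 0) * (s 0 / s (n+1))) ^ p := Real.rpow_le_rpow (by positivity) k1 hp0
    _ = (1 + 2 / s 0) ^ p * (s 0 / s (n+1)) ^ p := Real.mul_rpow (by positivity) (by positivity)
    _ ≤ (1 + 2 / s 0) * (s 0 / s (n+1)) ^ p := by
      refine mul_le_mul_of_nonneg_right ?_ (by positivity)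
      have : (1:ℝ) ≤ 1 + 2 / s 0 := by have : 0 < 2 / s 0 := by positivity
                                       linarith
      simpa using Real.rpow_le_rpow_of_exponent_le this hp1
theorem mono_add {d : ℕ} (α β : Fin d → ℕ) (x : Fin d → ℝ) : mono d (α + β) x = mono d α x * mono d β x := by
  simp [mono, pow_add, prod_mul_distrib]

theorem mono_nsmul {d : ℕ} (k : ℕ) (α : Fin d → ℕ) (x : Fin d → ℝ) : mono d (k • α) x = mono d α x ^ k := by
  simp [mono, ← prod_pow, mul_comm k, pow_mul]

theorem mono_single {d : ℕ} (i : Fin d) (n : ℕ) (x : Fin d → ℝ) : mono d (Pi.single i n) x = x i ^ n := by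
  classical
  rw [mono, prod_eq_single i]
  · simp
  · intro j _ hj; simp [Pi.single_eq_of_ne hj]
  · simp

theorem mono_meas {d : ℕ} (α : Fin d → ℕ) : Measurable (mono d α) := by
  unfold mono; fun_prop

theorem int_single {d : ℕ} {σ : Measure (Fin d → ℝ)} (h : HasAllMoments σ) (i : Fin d) (n : ℕ) :
    Integrable (fun x => x i ^ n) σ := by
  have := h (Pi.single i n)
  refine this.congr (Eventually.of_forall fun x => ?_)
  exact mono_single i n x

theorem s_lc {d : ℕ} {σ : Measure (Fin d → ℝ)} (h : HasAllMoments σ) (i : Fin d) (a b : ℕ) :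
    (∫ x, x i ^ (2*(a+b)) ∂σ) ^ 2 ≤ (∫ x, x i ^ (2*(2*a)) ∂σ) * ∫ x, x i ^ (2*(2*b)) ∂σ := by
  have e : ∀ (x : Fin d → ℝ) (c : ℕ), (x i ^ (2*c))^2 = x i ^ (2*(2*c)) := fun x c => by ring
  have := (cs_sq σ (fun x => x i ^ (2*a)) (fun x => x i ^ (2*b)) (Measurable.aestronglyMeasurable (by fun_prop)) (Measurable.aestronglyMeasurable (by fun_prop))
    (by simp only [e]; exact int_single h i _) (by simp only [e]; exact int_single h i _)).2
  simp only [e] at this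
  refine le_trans (le_of_eq ?_) this
  congr 1
  refine integral_congr_ae (Eventually.of_forall fun x => ?_)
  simp only
  rw [← abs_mul, ← pow_add, ← mul_add, abs_of_nonneg]
  exact (even_two_mul _).pow_nonneg _

theorem s_lc' {d : ℕ} {σ : Measure (Fin d → ℝ)} (h : HasAllMoments σ) (i : Fin d) (n : ℕ) :
    (∫ x, x i ^ (2*(n+1)) ∂σ) ^ 2 ≤ (∫ x, x i ^ (2*n) ∂σ) * ∫ x, x i ^ (2*(n+2)) ∂σ := by
  have e : ∀ (x : Fin d → ℝ) (c : ℕ), (x i ^ (c))^2 = x i ^ (2*c) := fun x c => by ring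
  have := (cs_sq σ (fun x => x i ^ (n)) (fun x => x i ^ (n+2)) (Measurable.aestronglyMeasurable (by fun_prop)) (Measurable.aestronglyMeasurable (by fun_prop))
    (by simp only [e]; exact int_single h i _) (by simp only [e]; exact int_single h i _)).2
  simp only [e] at this
  refine le_trans (le_of_eq ?_) this
  congr 1
  refine integral_congr_ae (Eventually.of_forall fun x => ?_)
  simp only
  rw [← abs_mul, ← pow_add, show n + (n+2) = 2*(n+1) by ring, abs_of_nonneg]
  exact (even_two_mul _).pow_nonneg _

theorem fourier_orth_zero {d : ℕ} (σ : Measure (Fin d → ℝ)) [IsFiniteMeasure σ] (hmom : HasAllMoments σ)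
    (g : (Fin d → ℝ) → ℝ) (hg : MemLp g 2 σ)
    (hs : ∀ i n, 0 < ∫ x, x i ^ (2*n) ∂σ)
    (hdiv : ∀ i (C : ℝ), 0 < C → ¬ Summable (fun n : ℕ => √√(C * ∫ x, x i ^ (2*(2*n)) ∂σ) / √√(C * ∫ x, x i ^ (2*(2*(n+1))) ∂σ)))
    (horth : ∀ α, ∫ x, mono d α x * g x ∂σ = 0) (t : Fin d → ℝ) (S : Finset (Fin d)) :
    ∀ α, ∫ x, Complex.exp (Complex.I * (∑ i ∈ S, t i * x i : ℝ)) * ((mono d α x * g x : ℝ) : ℂ) ∂σ = 0 := by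
  classical
  induction S using Finset.induction_on with
  | empty =>
    intro α
    simp only [sum_empty, Complex.ofReal_zero, mul_zero, Complex.exp_zero, one_mul]
    rw [integral_complex_ofReal, horth]; simp
  | insert i S hi ih =>
    intro α
    have hgm := hg.aestronglyMeasurable
    have hg2 : Integrable (fun x => g x ^ 2) σ := (memLp_two_iff_integrable_sq hgm).1 hg
    set E : (Fin d → ℝ) → ℂ := fun x => Complex.exp (Complex.I * (∑ i ∈ S, t i * x i : ℝ)) with hEdef
    have hEm : Measurable E := by simp only [hEdef]; fun_prop
    have hEn : ∀ x, ‖E x‖ = 1 := fun x => by simp only [hEdef]; rw [mul_comm, Complex.norm_exp_ofReal_mul_I]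
    have hmm := mono_meas α
    -- integrability and bound
    have e0 : ∀ (n : ℕ) x, (x i ^ n * mono d α x)^2 = x i ^ (2*n) * mono d (2 • α) x := fun n x => by
      rw [mono_nsmul]; ring
    have c1 : ∀ n : ℕ, Integrable (fun x => x i ^ (2*n) * mono d (2 • α) x) σ ∧
        (∫ x, |x i ^ (2*n)| * |mono d (2 • α) x| ∂σ) ^ 2 ≤ (∫ x, x i ^ (2*(2*n)) ∂σ) * ∫ x, mono d (4 • α) x ∂σ := by
      intro n
      have q1 : ∀ x : Fin d → ℝ, (x i ^ (2*n))^2 = x i ^ (2*(2*n)) := fun x => by ring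
      have q2 : ∀ x : Fin d → ℝ, (mono d (2 • α) x)^2 = mono d (4 • α) x := fun x => by
        rw [mono_nsmul, mono_nsmul]; ring
      have := cs_sq σ (fun x => x i ^ (2*n)) (mono d (2 • α)) (Measurable.aestronglyMeasurable (by fun_prop)) (mono_meas _).aestronglyMeasurable
        (by simp only [q1]; exact int_single hmom i _) (by simp only [q2]; exact hmom _)
      simpa only [q1, q2] using this
    have c2 : ∀ n : ℕ, Integrable (fun x => (x i ^ n * mono d α x) * g x) σ ∧
        (∫ x, |x i ^ n * mono d α x| * |g x| ∂σ) ^ 2 ≤ (∫ x, x i ^ (2*n) * mono d (2 • α) x ∂σ) * ∫ x, g x ^ 2 ∂σ := by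
      intro n
      have := cs_sq σ (fun x => x i ^ n * mono d α x) g (by fun_prop) hgm
        (by simp only [e0]; exact (c1 n).1) hg2
      simpa only [e0] using this
    set C : ℝ := (∫ x, mono d (4 • α) x ∂σ) * (∫ x, g x ^ 2 ∂σ) ^ 2 + 1 with hC
    have h4pos : 0 ≤ ∫ x, mono d (4 • α) x ∂σ := integral_nonneg fun x => by
      simp only [Pi.zero_apply]; rw [mono_nsmul]; exact (by decide : Even 4).pow_nonneg _
    have hCpos : 0 < C := by positivity
    set h : (Fin d → ℝ) → ℂ := fun x => E x * ((mono d α x * g x : ℝ) : ℂ) with hh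
    have hnorm : ∀ (n : ℕ) x, |x i| ^ n * ‖h x‖ = |x i ^ n * mono d α x| * |g x| := by
      intro n x
      simp only [hh]
      rw [norm_mul, hEn, one_mul, Complex.norm_real, Real.norm_eq_abs, abs_mul, abs_mul, abs_pow]; ring
    have main := quasi_core σ (fun x => x i) (measurable_pi_apply i) h
      (hEm.aestronglyMeasurable.mul (Complex.continuous_ofReal.comp_aestronglyMeasurable (hmm.aestronglyMeasurable.mul hgm)))
      (fun n => by
        simp only [hnorm, ← abs_mul]
        exact (c2 n).1.abs)
      (fun n => √√(C * ∫ x, x i ^ (2*(2*n)) ∂σ))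
      (fun n => by have := hs i (2*n); positivity)
      (fun n => by
        have p0 := hs i (2*n)
        have p1 := hs i (2*(n+1))
        have p2 := hs i (2*(n+2))
        rw [Real.sq_sqrt (Real.sqrt_nonneg _), ← Real.sqrt_mul (Real.sqrt_nonneg _)]
        apply Real.sqrt_le_sqrt
        rw [← Real.sqrt_mul (by positivity)]
        apply Real.le_sqrt_of_sq_le
        have := s_lc hmom i n (n+2)
        rw [show n + (n+2) = 2*(n+1) by ring] at this
        have hC2 : 0 ≤ C^2 := by positivity
        nlinarith [mul_le_mul_of_nonneg_left this hC2])
      (fun n => by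
        simp only [hnorm]
        apply Real.le_sqrt_of_sq_le
        apply Real.le_sqrt_of_sq_le
        have a1 := (c2 n).2
        have a2 := (c1 n).2
        have e : ∫ x, |x i ^ (2*n)| * |mono d (2 • α) x| ∂σ = ∫ x, x i ^ (2*n) * mono d (2 • α) x ∂σ := by
          refine integral_congr_ae (Eventually.of_forall fun x => ?_)
          simp only
          rw [← abs_mul, ← e0, abs_of_nonneg (sq_nonneg _)]
        rw [e] at a2
        set A := ∫ x, |x i ^ n * mono d α x| * |g x| ∂σ
        set B := ∫ x, x i ^ (2*n) * mono d (2 • α) x ∂σ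
        set G := ∫ x, g x ^ 2 ∂σ
        set D := ∫ x, mono d (4 • α) x ∂σ
        have sp := hs i (2*n)
        calc (A^2)^2 ≤ (B*G)^2 := pow_le_pow_left₀ (sq_nonneg _) a1 2
          _ = B^2 * G^2 := by ring
          _ ≤ ((∫ x, x i ^ (2*(2*n)) ∂σ) * D) * G^2 := mul_le_mul_of_nonneg_right a2 (sq_nonneg _)
          _ ≤ C * (∫ x, x i ^ (2*(2*n)) ∂σ) := by rw [hC]; nlinarith)
      (hdiv i C hCpos)
      (fun n => by
        rw [← ih (Pi.single i n + α)]
        refine integral_congr_ae (Eventually.of_forall fun x => ?_)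
        simp only [hh, hEdef, mono_add, mono_single]
        push_cast; ring)
      (t i)
    rw [← main]
    refine integral_congr_ae (Eventually.of_forall fun x => ?_)
    simp only [hh, hEdef]
    rw [← mul_assoc, ← Complex.exp_add, sum_insert hi]
    congr 2
    push_cast; ring

theorem g_zero {d : ℕ} (σ : Measure (Fin d → ℝ)) [IsFiniteMeasure σ]
    (g : (Fin d → ℝ) → ℝ) (hgi : Integrable g σ)
    (hF : ∀ t : Fin d → ℝ, ∫ x, Complex.exp (Complex.I * (∑ i, t i * x i : ℝ)) * ((g x : ℝ) : ℂ) ∂σ = 0) :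
    g =ᵐ[σ] 0 := by
  have hm1 : AEMeasurable (fun x => ENNReal.ofReal (g x)) σ := hgi.aemeasurable.ennreal_ofReal
  have hm2 : AEMeasurable (fun x => ENNReal.ofReal (-g x)) σ := hgi.aemeasurable.neg.ennreal_ofReal
  have f1 : IsFiniteMeasure (σ.withDensity fun x => ENNReal.ofReal (g x)) :=
    isFiniteMeasure_withDensity_ofReal hgi.2
  have f2 : IsFiniteMeasure (σ.withDensity fun x => ENNReal.ofReal (-g x)) :=
    isFiniteMeasure_withDensity_ofReal hgi.neg.2
  have heq : (σ.withDensity fun x => ENNReal.ofReal (g x)) = σ.withDensity fun x => ENNReal.ofReal (-g x) := by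
    apply Measure.ext_of_charFunDual
    funext L
    rw [charFunDual_apply, charFunDual_apply,
      integral_withDensity_eq_integral_toReal_smul₀ hm1 (Eventually.of_forall fun x => ENNReal.ofReal_lt_top),
      integral_withDensity_eq_integral_toReal_smul₀ hm2 (Eventually.of_forall fun x => ENNReal.ofReal_lt_top),
      ← sub_eq_zero, ← integral_sub]
    · classical
      rw [← hF (fun i => L (Pi.single i 1))]
      refine integral_congr_ae (Eventually.of_forall fun x => ?_)
      have hL : L x = ∑ i, L (Pi.single i 1) * x i := by
        conv_lhs => rw [pi_eq_sum_univ' x, map_sum]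
        refine sum_congr rfl fun i _ => ?_
        rw [map_smul, smul_eq_mul, mul_comm]
      simp only
      rw [← sub_smul, ← hL, mul_comm Complex.I, mul_comm (Complex.exp _)]
      rw [Complex.real_smul]
      congr 2
      rw [ENNReal.toReal_ofReal', ENNReal.toReal_ofReal']
      exact max_zero_sub_eq_self (g x)
    · have hp := (hgi.pos_part.ofReal (𝕜 := ℂ))
      refine hp.norm.mono' ?_ (Eventually.of_forall fun x => ?_)
      · have ha := hm1.ennreal_toReal.aestronglyMeasurable
        have hb : AEStronglyMeasurable (fun x => Complex.exp (L x * Complex.I)) σ :=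
          Measurable.aestronglyMeasurable (by fun_prop)
        exact ha.smul hb
      · rw [norm_smul, Complex.norm_exp_ofReal_mul_I, mul_one, ENNReal.toReal_ofReal', RCLike.norm_ofReal]
        exact le_of_eq (Real.norm_eq_abs _)
    · have hp := (hgi.neg.pos_part.ofReal (𝕜 := ℂ))
      refine hp.norm.mono' ?_ (Eventually.of_forall fun x => ?_)
      · have ha := hm2.ennreal_toReal.aestronglyMeasurable
        have hb : AEStronglyMeasurable (fun x => Complex.exp (L x * Complex.I)) σ :=
          Measurable.aestronglyMeasurable (by fun_prop)
        exact ha.smul hb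
      · rw [norm_smul, Complex.norm_exp_ofReal_mul_I, mul_one, ENNReal.toReal_ofReal', RCLike.norm_ofReal]
        exact le_of_eq (Real.norm_eq_abs _)
  have := (withDensity_eq_iff_of_sigmaFinite hm1 hm2).1 heq
  filter_upwards [this] with x hx
  have h1 := congrArg ENNReal.toReal hx
  rw [ENNReal.toReal_ofReal', ENNReal.toReal_ofReal'] at h1
  have := max_zero_sub_eq_self (g x)
  simp only [Pi.zero_apply]
  rw [← this, h1, sub_self]
theorem quad_form {d n : ℕ} (σ : Measure (Fin d → ℝ)) (hmom : HasAllMoments σ)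
    (v : {α : Fin d → ℕ // ∑ i, α i ≤ n} → ℝ) :
    dotProduct (star v) (Matrix.mulVec (momMat d n (mMom σ)) v) = ∫ x, (∑ a, v a * mono d a.1 x) ^ 2 ∂σ := by
  have e : ∀ x, (∑ a, v a * mono d a.1 x) ^ 2 = ∑ a, ∑ b, (v a * v b) * mono d (a.1 + b.1) x := by
    intro x
    rw [sq, sum_mul_sum]
    refine sum_congr rfl fun a _ => sum_congr rfl fun b _ => ?_
    rw [mono_add]; ring
  simp only [e]
  rw [integral_finsetSum _ (fun a _ => integrable_finsetSum _ fun b _ => (hmom _).const_mul _)]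
  simp only [dotProduct, Matrix.mulVec, mul_sum]
  refine sum_congr rfl fun a _ => ?_
  rw [integral_finsetSum _ (fun b _ => (hmom _).const_mul _)]
  refine sum_congr rfl fun b _ => ?_
  rw [integral_const_mul]
  simp only [momMat, mMom, Pi.star_apply, star_trivial]
  ring

theorem sq_int {d : ℕ} {ι : Type*} (s : Finset ι) (e : ι → Fin d → ℕ) (σ : Measure (Fin d → ℝ)) (hmom : HasAllMoments σ)
    (v : ι → ℝ) : Integrable (fun x => (∑ a ∈ s, v a * mono d (e a) x) ^ 2) σ := by
  have e : ∀ x, (∑ a ∈ s, v a * mono d (e a) x) ^ 2 = ∑ a ∈ s, ∑ b ∈ s, (v a * v b) * mono d (e a + e b) x := by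
    intro x
    rw [sq, sum_mul_sum]
    refine sum_congr rfl fun a _ => sum_congr rfl fun b _ => ?_
    rw [mono_add]; ring
  simp only [e]
  exact integrable_finsetSum _ fun a _ => integrable_finsetSum _ fun b _ => (hmom _).const_mul _

theorem poly_le {d : ℕ} (μ φ : Measure (Fin d → ℝ)) (hμ : HasAllMoments μ) (hφ : HasAllMoments φ)
    (h : ∀ n : ℕ, (momMat d n (mMom μ) - momMat d n (mMom φ)).PosSemidef) (S : Finset (Fin d → ℕ)) (c : (Fin d → ℕ) → ℝ) :
    ∫ x, (∑ a ∈ S, c a * mono d a x) ^ 2 ∂φ ≤ ∫ x, (∑ a ∈ S, c a * mono d a x) ^ 2 ∂μ := by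
  classical
  set n := S.sup fun a => ∑ i, a i with hn
  set v : {α : Fin d → ℕ // ∑ i, α i ≤ n} → ℝ := fun a => if a.1 ∈ S then c a.1 else 0 with hv
  have e : ∀ x, ∑ a, v a * mono d a.1 x = ∑ a ∈ S, c a * mono d a x := by
    intro x
    have : ∑ a ∈ S, c a * mono d a x = ∑ a ∈ univ.map (Function.Embedding.subtype fun α : Fin d → ℕ => ∑ i, α i ≤ n),
        (if a ∈ S then c a else 0) * mono d a x := by
      have h1 : ∑ a ∈ S, c a * mono d a x = ∑ a ∈ S, (if a ∈ S then c a else 0) * mono d a x :=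
        sum_congr rfl fun a ha => by rw [if_pos ha]
      rw [h1]
      apply sum_subset
      · intro a ha
        simp only [Finset.mem_map, mem_univ, true_and, Function.Embedding.subtype_apply, Subtype.exists, exists_prop, exists_eq_right]
        exact le_sup (f := fun a : Fin d → ℕ => ∑ i, a i) ha
      · intro a _ ha; simp [ha]
    rw [this, sum_map]
    rfl
  have := (Matrix.posSemidef_iff_dotProduct_mulVec.1 (h n)).2 v
  rw [Matrix.sub_mulVec, dotProduct_sub, quad_form μ hμ, quad_form φ hφ] at this
  simp only [e] at this
  linarith

theorem dense_main {d : ℕ} (σ : Measure (Fin d → ℝ)) [IsFiniteMeasure σ] (hmom : HasAllMoments σ)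
    (hs : ∀ i n, 0 < ∫ x, x i ^ (2*n) ∂σ)
    (hdiv : ∀ i (C : ℝ), 0 < C → ¬ Summable (fun n : ℕ => √√(C * ∫ x, x i ^ (2*(2*n)) ∂σ) / √√(C * ∫ x, x i ^ (2*(2*(n+1))) ∂σ)))
    (f : (Fin d → ℝ) → ℝ) (hf : MemLp f 2 σ) (ε : ENNReal) (hε : ε ≠ 0) :
    ∃ (S : Finset (Fin d → ℕ)) (c : (Fin d → ℕ) → ℝ), eLpNorm (fun x => f x - ∑ a ∈ S, c a * mono d a x) 2 σ ≤ ε := by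
  have hL : ∀ α, MemLp (mono d α) 2 σ := fun α =>
    (memLp_two_iff_integrable_sq (mono_meas α).aestronglyMeasurable).2 (by
      simp only [← mono_nsmul]; exact hmom _)
  set K : Submodule ℝ (Lp ℝ 2 σ) := Submodule.span ℝ (Set.range fun α => (hL α).toLp (mono d α)) with hK
  have hKtop : K.topologicalClosure = ⊤ := by
    rw [Submodule.topologicalClosure_eq_top_iff, Submodule.eq_bot_iff]
    intro g hg
    have horth : ∀ α, ∫ x, mono d α x * g x ∂σ = 0 := by
      intro α
      have h1 := (Submodule.mem_orthogonal _ _).1 hg _ (Submodule.subset_span ⟨α, rfl⟩)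
      rw [L2.inner_def] at h1
      rw [← h1]
      refine integral_congr_ae ?_
      filter_upwards [(hL α).coeFn_toLp] with x hx
      simp only [hx]
      simp [mul_comm]
    have hgm : MemLp g 2 σ := Lp.memLp g
    have h0 := g_zero σ g (hgm.integrable (by norm_num)) (fun t => by
      have := fourier_orth_zero σ hmom g hgm hs hdiv horth t univ 0
      simpa [mono] using this)
    exact (Lp.eq_zero_iff_ae_eq_zero).2 h0
  have hmem : hf.toLp f ∈ closure (K : Set (Lp ℝ 2 σ)) := by
    rw [← Submodule.topologicalClosure_coe, hKtop]; trivial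
  obtain ⟨p, hpK, hp⟩ := Metric.mem_closure_iff.1 hmem (min ε 1).toReal
    (ENNReal.toReal_pos (by simp [hε]) (by simp))
  obtain ⟨c, hc⟩ := Finsupp.mem_span_range_iff_exists_finsupp.1 hpK
  refine ⟨c.support, c, ?_⟩
  have hfin : MemLp (fun x => ∑ a ∈ c.support, c a * mono d a x) 2 σ :=
    memLp_finsetSum _ fun a _ => (hL a).const_mul _
  have hpe : p = hfin.toLp _ := by
    rw [← hc]
    apply Lp.ext
    refine EventuallyEq.trans ?_ hfin.coeFn_toLp.symm
    have := Lp.coeFn_finsetSum (c.support) (fun a => c a • (hL a).toLp (mono d a))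
    refine this.trans ?_
    have h2 : ∀ᵐ x ∂σ, ∀ a ∈ c.support, (c a • (hL a).toLp (mono d a) : Lp ℝ 2 σ) x = c a * mono d a x := by
      rw [eventually_all_finset]
      intro a _
      filter_upwards [Lp.coeFn_smul (c a) ((hL a).toLp (mono d a)), (hL a).coeFn_toLp] with x h1 h2
      rw [h1, Pi.smul_apply, h2, smul_eq_mul]
    filter_upwards [h2] with x hx
    simp only [Finset.sum_apply]
    exact sum_congr rfl hx
  rw [hpe, dist_edist, Lp.edist_toLp_toLp] at hp
  have h3 : eLpNorm (f - fun x => ∑ a ∈ c.support, c a * mono d a x) 2 σ ≠ ⊤ := (hf.sub hfin).2.ne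
  have h4 := (ENNReal.toReal_lt_toReal h3 (by simp)).1 hp
  exact h4.le.trans (min_le_left _ _)

/-- For finite Borel measures `μ, φ` on `ℝ^d` with all moments finite,
`μ` satisfying Carleman's condition, one has `φ ≤ μ` iff `M_n(φ) ⪯ M_n(μ)` for all `n`. -/
theorem domination_iff_momentMatrix_le (d : ℕ) (μ φ : Measure (Fin d → ℝ))
    [IsFiniteMeasure μ] [IsFiniteMeasure φ]
    (hμmom : HasAllMoments μ) (hφmom : HasAllMoments φ) (hcar : Carleman μ) :
    φ ≤ μ ↔ ∀ n : ℕ, (momMat d n (mMom μ) - momMat d n (mMom φ)).PosSemidef := by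
  constructor
  · intro hle n
    refine Matrix.posSemidef_iff_dotProduct_mulVec.2 ⟨?_, fun v => ?_⟩
    · ext a b
      simp [momMat, add_comm]
    · rw [Matrix.sub_mulVec, dotProduct_sub, quad_form μ hμmom, quad_form φ hφmom, sub_nonneg]
      exact integral_mono_measure hle (Eventually.of_forall fun x => sq_nonneg _)
        (sq_int univ (fun a : {α : Fin d → ℕ // ∑ i, α i ≤ n} => a.1) μ hμmom v)
  · intro h
    set σ := μ + φ with hσ
    have hmom : HasAllMoments σ := fun α => (hμmom α).add_measure (hφmom α)
    have hle1 : μ ≤ σ := Measure.le_add_right le_rfl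
    have hle2 : φ ≤ σ := Measure.le_add_left le_rfl
    have hnn : ∀ (ν : Measure (Fin d → ℝ)) i n, 0 ≤ ∫ x, x i ^ (2*n) ∂ν := fun ν i n =>
      integral_nonneg fun x => (even_two_mul n).pow_nonneg _
    have hsadd : ∀ i n, ∫ x, x i ^ (2*n) ∂σ = ∫ x, x i ^ (2*n) ∂μ + ∫ x, x i ^ (2*n) ∂φ := fun i n =>
      integral_add_measure (int_single hμmom i _) (int_single hφmom i _)
    have hφμ : ∀ i n, ∫ x, x i ^ (2*n) ∂φ ≤ ∫ x, x i ^ (2*n) ∂μ := by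
      intro i n
      have := poly_le μ φ hμmom hφmom h {Pi.single i n} (fun _ => 1)
      simpa [mono_single, ← pow_mul, mul_comm] using this
    have hμpos : ∀ i n, 0 < ∫ x, x i ^ (2*n) ∂μ := by
      intro i n
      refine lt_of_le_of_ne (hnn μ i n) fun h0 => ?_
      have hz : ∀ᵐ x ∂μ, x i ^ (2*n) = 0 := by
        have := (integral_eq_zero_iff_of_nonneg (μ := μ) (f := fun x : Fin d → ℝ => x i ^ (2*n))
          (fun x => (even_two_mul n).pow_nonneg _) (int_single hμmom i _)).1 h0.symm
        exact this
      apply hcar i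
      have : ∀ j : ℕ, ∫ x, x i ^ (2 * (j+1)) ∂μ = 0 := by
        intro j
        rw [← integral_zero (Fin d → ℝ) ℝ (μ := μ)]
        refine integral_congr_ae ?_
        filter_upwards [hz] with x hx
        have hx0 : x i = 0 := by
          by_contra hne
          exact pow_ne_zero _ hne hx
        simp [hx0]
      simp only [this]
      have e : ∀ j : ℕ, (0:ℝ) ^ (-(1:ℝ) / (2 * ((j:ℝ)+1))) = 0 := fun j =>
        Real.zero_rpow (by
          have : (0:ℝ) < (j:ℝ) + 1 := by positivity
          exact div_ne_zero (by norm_num) (by positivity))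
      simp only [e]
      exact summable_zero
    have hs : ∀ i n, 0 < ∫ x, x i ^ (2*n) ∂σ := fun i n => by
      rw [hsadd]; have := hμpos i n; have := hnn φ i n; linarith
    have hdiv : ∀ i (C : ℝ), 0 < C → ¬ Summable (fun n : ℕ => √√(C * ∫ x, x i ^ (2*(2*n)) ∂σ) / √√(C * ∫ x, x i ^ (2*(2*(n+1))) ∂σ)) := by
      intro i C hC
      exact ratio_div (fun n => ∫ x, x i ^ (2*n) ∂σ) (fun n => ∫ x, x i ^ (2*n) ∂μ) C hC (hs i)
        (fun n => s_lc' hmom i n) (fun n => by simp only [hsadd]; have := hφμ i n; linarith) (hcar i)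
    rw [Measure.le_iff]
    intro B hB
    have hf : MemLp (B.indicator fun _ => (1:ℝ)) 2 σ := memLp_indicator_const 2 hB 1 (Or.inr (measure_ne_top _ _))
    have key : eLpNorm (B.indicator fun _ => (1:ℝ)) 2 φ ≤ eLpNorm (B.indicator fun _ => (1:ℝ)) 2 μ := by
      refine ENNReal.le_of_forall_pos_le_add fun ε hε _ => ?_
      obtain ⟨S, c, hc⟩ := dense_main σ hmom hs hdiv _ hf ((ε / 2 : NNReal) : ENNReal) (by
        have : ε / 2 ≠ 0 := by positivity
        exact_mod_cast this)
      set f : (Fin d → ℝ) → ℝ := B.indicator fun _ => (1:ℝ) with hfdef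
      set p : (Fin d → ℝ) → ℝ := fun x => ∑ a ∈ S, c a * mono d a x with hp
      have hpm : Measurable p := by
        simp only [hp]
        exact Finset.measurable_fun_sum _ fun a _ => (mono_meas a).const_mul _
      have hfm : Measurable f := measurable_const.indicator hB
      have hpp : eLpNorm p 2 φ ≤ eLpNorm p 2 μ := by
        have i1 := sq_int S id φ hφmom c
        have i2 := sq_int S id μ hμmom c
        have m1 := (memLp_two_iff_integrable_sq hpm.aestronglyMeasurable).2 i1
        have m2 := (memLp_two_iff_integrable_sq hpm.aestronglyMeasurable).2 i2
        rw [m1.eLpNorm_eq_integral_rpow_norm (by norm_num) (by norm_num), m2.eLpNorm_eq_integral_rpow_norm (by norm_num) (by norm_num)]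
        apply ENNReal.ofReal_le_ofReal
        refine Real.rpow_le_rpow (integral_nonneg fun x => by positivity) ?_ (by positivity)
        simp only [ENNReal.toReal_ofNat, Real.rpow_two, Real.norm_eq_abs, sq_abs]
        exact poly_le μ φ hμmom hφmom h S c
      have t1 : eLpNorm f 2 φ ≤ eLpNorm (f - p) 2 φ + eLpNorm p 2 φ := by
        have := eLpNorm_add_le (μ := φ) (p := 2) (f := f - p) (g := p) (hfm.sub hpm).aestronglyMeasurable hpm.aestronglyMeasurable (by norm_num)
        simpa using this
      have t2 : eLpNorm p 2 μ ≤ eLpNorm (f - p) 2 μ + eLpNorm f 2 μ := by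
        have := eLpNorm_sub_le (μ := μ) (p := 2) (f := f) (g := f - p) hfm.aestronglyMeasurable (hfm.sub hpm).aestronglyMeasurable (by norm_num)
        rw [add_comm]
        simpa using this
      have t3 : eLpNorm (f - p) 2 φ ≤ ((ε / 2 : NNReal) : ENNReal) := (eLpNorm_mono_measure _ hle2).trans hc
      have t4 : eLpNorm (f - p) 2 μ ≤ ((ε / 2 : NNReal) : ENNReal) := (eLpNorm_mono_measure _ hle1).trans hc
      calc eLpNorm f 2 φ ≤ ((ε / 2 : NNReal) : ENNReal) + (((ε / 2 : NNReal) : ENNReal) + eLpNorm f 2 μ) :=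
            t1.trans (add_le_add t3 (hpp.trans (t2.trans (add_le_add t4 le_rfl))))
        _ = eLpNorm f 2 μ + ε := by
          rw [← add_assoc, ← ENNReal.coe_add, add_halves, add_comm]
    rw [eLpNorm_indicator_const hB (by norm_num) (by norm_num), eLpNorm_indicator_const hB (by norm_num) (by norm_num)] at key
    simp only [enorm_one, one_mul] at key
    exact (ENNReal.rpow_le_rpow_iff (by norm_num)).1 key

end
end

section
/- Let μ and ν be finite positive Borel measures on ℝ^d satisfying Assumption 1. Then the infimum of φ⁺(ℝ^d) + φ⁻(ℝ^d) over all pairs (φ⁺, φ⁻) of finite positive Borel measures on ℝ^d with all moments finite satisfying ∫ x^α dφ⁺ − ∫ x^α dφ⁻ = ∫ x^α dμ − ∫ x^α dν for every α ∈ ℕ^d and, for all n ∈ ℕ, M_n(φ⁺) ⪯ M_n(μ) and M_n(φ⁻) ⪯ M_n(ν), equals ‖μ − ν‖_TV, and it is attained uniquely at the Hahn–Jordan decomposition (φ⁺*, φ⁻*) of μ − ν. -/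
open MeasureTheory Finset Filter

noncomputable section

/-- Assumption 1: all moments of `μ` and `ν` are finite, and there is `c > 0` with
`∫ exp(c|x_i|) dμ < ∞` and `∫ exp(c|x_i|) dν < ∞` for every coordinate `i`. -/
def Assumption1 {d : ℕ} (μ ν : Measure (Fin d → ℝ)) : Prop :=
  HasAllMoments μ ∧ HasAllMoments ν ∧
  ∃ c : ℝ, 0 < c ∧ (∀ i : Fin d, Integrable (fun x => Real.exp (c * |x i|)) μ) ∧
    (∀ i : Fin d, Integrable (fun x => Real.exp (c * |x i|)) ν)

open scoped ENNReal

/-- Exponential integrability of all coordinates with a common rate `c`. -/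
def CoshInt {d : ℕ} (c : ℝ) (μ : Measure (Fin d → ℝ)) : Prop :=
  ∀ i : Fin d, Integrable (fun x => Real.cosh (c * x i)) μ

lemma aux_coshInt_of_exp {d : ℕ} {c : ℝ} (hc : 0 < c) {μ : Measure (Fin d → ℝ)}
    (h : ∀ i : Fin d, Integrable (fun x => Real.exp (c * |x i|)) μ) : CoshInt c μ := by
  intro i
  have hm : Measurable (fun x : Fin d → ℝ => Real.cosh (c * x i)) :=
    Real.measurable_cosh.comp (by fun_prop)
  refine (h i).mono' hm.aestronglyMeasurable (Filter.Eventually.of_forall fun x => ?_)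
  rw [Real.norm_of_nonneg (Real.cosh_pos _).le, ← Real.cosh_abs, abs_mul, abs_of_pos hc,
    Real.cosh_eq]
  have : Real.exp (-(c * |x i|)) ≤ Real.exp (c * |x i|) := by
    apply Real.exp_le_exp.2
    have : 0 ≤ c * |x i| := by positivity
    linarith
  linarith

lemma aux_mono_single {d : ℕ} (i : Fin d) (k : ℕ) (x : Fin d → ℝ) :
    mono d (Pi.single i k) x = x i ^ k := by
  unfold mono
  rw [Finset.prod_eq_single i]
  · simp
  · intro b _ hb
    simp [Pi.single_eq_of_ne hb]
  · simp

lemma aux_even_moment_le {d : ℕ} {μ φ : Measure (Fin d → ℝ)}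
    (h : ∀ n : ℕ, (momMat d n (mMom μ) - momMat d n (mMom φ)).PosSemidef) (i : Fin d) (k : ℕ) :
    ∫ x, x i ^ (2 * k) ∂φ ≤ ∫ x, x i ^ (2 * k) ∂μ := by
  have h1 := (h k).diag_nonneg (i := ⟨Pi.single i k, by simp⟩)
  have h3 : (Pi.single i k + Pi.single i k : Fin d → ℕ) = Pi.single i (2 * k) := by
    rw [← Pi.single_add, two_mul]
  simp only [momMat, Matrix.sub_apply, h3, mMom, aux_mono_single] at h1
  linarith

lemma aux_lintegral_cosh {d : ℕ} (μ : Measure (Fin d → ℝ)) (hμ : HasAllMoments μ) (c : ℝ)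
    (i : Fin d) :
    ∫⁻ x, ENNReal.ofReal (Real.cosh (c * x i)) ∂μ =
      ∑' k : ℕ, ENNReal.ofReal (c ^ (2 * k) / (2 * k).factorial * ∫ x, x i ^ (2 * k) ∂μ) := by
  have h1 : ∀ x : Fin d → ℝ, ENNReal.ofReal (Real.cosh (c * x i)) =
      ∑' k : ℕ, ENNReal.ofReal (c ^ (2 * k) / (2 * k).factorial * x i ^ (2 * k)) := by
    intro x
    have hs := Real.hasSum_cosh (c * x i)
    rw [← hs.tsum_eq, ENNReal.ofReal_tsum_of_nonneg _ hs.summable]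
    · congr 1
      ext k
      congr 1
      rw [mul_pow]
      ring
    · intro k
      rw [pow_mul]
      positivity
  simp_rw [h1]
  rw [lintegral_tsum (fun k => (Measurable.ennreal_ofReal (by fun_prop)).aemeasurable)]
  congr 1
  ext k
  have hi : Integrable (fun x : Fin d → ℝ => x i ^ (2 * k)) μ := by
    have := hμ (Pi.single i (2 * k))
    simpa only [funext (aux_mono_single i (2 * k))] using this
  rw [← ofReal_integral_eq_lintegral_ofReal (hi.const_mul _), integral_const_mul]
  refine Filter.Eventually.of_forall fun x => ?_
  simp only [pow_mul, Pi.zero_apply]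
  positivity

lemma aux_coshInt_of_le {d : ℕ} {c : ℝ} {μ φ : Measure (Fin d → ℝ)}
    (hμ : HasAllMoments μ) (hφ : HasAllMoments φ)
    (h : ∀ n : ℕ, (momMat d n (mMom μ) - momMat d n (mMom φ)).PosSemidef)
    (hc : CoshInt c μ) : CoshInt c φ := by
  intro i
  have hm : Measurable (fun x : Fin d → ℝ => Real.cosh (c * x i)) :=
    Real.measurable_cosh.comp (by fun_prop)
  refine (lintegral_ofReal_ne_top_iff_integrable hm.aestronglyMeasurable
    (Filter.Eventually.of_forall fun x => (Real.cosh_pos _).le)).1 ?_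
  have h2 := (lintegral_ofReal_ne_top_iff_integrable hm.aestronglyMeasurable
    (Filter.Eventually.of_forall fun x => (Real.cosh_pos _).le)).2 (hc i)
  refine ne_top_of_le_ne_top h2 ?_
  rw [aux_lintegral_cosh μ hμ, aux_lintegral_cosh φ hφ]
  refine ENNReal.tsum_le_tsum fun k => ENNReal.ofReal_le_ofReal ?_
  refine mul_le_mul_of_nonneg_left (aux_even_moment_le h i k) ?_
  rw [pow_mul]
  positivity

lemma aux_exp_norm_le {d : ℕ} {c : ℝ} (hc : 0 < c) (x : Fin d → ℝ) :
    Real.exp (c * ‖x‖) ≤ 1 + ∑ i, 2 * Real.cosh (c * x i) := by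
  have hS : 0 ≤ ∑ i, 2 * Real.cosh (c * x i) :=
    Finset.sum_nonneg fun i _ => by have := Real.cosh_pos (c * x i); positivity
  have hlog : 0 ≤ Real.log (1 + ∑ i, 2 * Real.cosh (c * x i)) := Real.log_nonneg (by linarith)
  rw [← Real.le_log_iff_exp_le (by linarith), ← le_div_iff₀' hc,
    pi_norm_le_iff_of_nonneg (by positivity)]
  intro i
  rw [le_div_iff₀' hc, Real.le_log_iff_exp_le (by linarith)]
  have h1 : 2 * Real.cosh (c * x i) ≤ ∑ i, 2 * Real.cosh (c * x i) :=
    Finset.single_le_sum (f := fun i => 2 * Real.cosh (c * x i))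
      (fun i _ => by have := Real.cosh_pos (c * x i); positivity) (Finset.mem_univ i)
  have h2 : Real.exp (c * ‖x i‖) ≤ 2 * Real.cosh (c * x i) := by
    rw [← Real.cosh_abs, abs_mul, abs_of_pos hc, Real.cosh_eq, Real.norm_eq_abs]
    have := Real.exp_pos (-(c * |x i|))
    linarith
  linarith

lemma aux_integrableExp {d : ℕ} {c : ℝ} (hc : 0 < c) {σ : Measure (Fin d → ℝ)}
    [IsFiniteMeasure σ] (h : CoshInt c σ) (L : StrongDual ℝ (Fin d → ℝ)) {s : ℝ}
    (hs : |s| < c / (‖L‖ + 1)) : s ∈ ProbabilityTheory.integrableExpSet L σ := by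
  have hint : Integrable (fun x : Fin d → ℝ => 1 + ∑ i, 2 * Real.cosh (c * x i)) σ :=
    (integrable_const _).add (integrable_finsetSum _ fun i _ => (h i).const_mul 2)
  refine hint.mono' (by fun_prop) (Filter.Eventually.of_forall fun x => ?_)
  rw [Real.norm_of_nonneg (Real.exp_pos _).le]
  refine le_trans (Real.exp_le_exp.2 ?_) (aux_exp_norm_le hc x)
  have hL : 0 < ‖L‖ + 1 := by positivity
  rw [lt_div_iff₀ hL] at hs
  calc s * L x ≤ |s * L x| := le_abs_self _
    _ = |s| * ‖L x‖ := by rw [abs_mul, Real.norm_eq_abs]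
    _ ≤ |s| * (‖L‖ * ‖x‖) := by gcongr; exact L.le_opNorm x
    _ ≤ |s| * ((‖L‖ + 1) * ‖x‖) := by gcongr; linarith
    _ = (|s| * (‖L‖ + 1)) * ‖x‖ := by ring
    _ ≤ c * ‖x‖ := by gcongr

lemma aux_dual_pow {d : ℕ} (L : StrongDual ℝ (Fin d → ℝ)) (n : ℕ) (x : Fin d → ℝ) :
    L x ^ n = ∑ k ∈ Finset.piAntidiag Finset.univ n,
      ((Nat.multinomial Finset.univ k : ℝ) * ∏ i, L (Pi.single i 1) ^ k i) * mono d k x := by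
  have h1 : L x = ∑ i, L (Pi.single i 1) * x i := by
    conv_lhs => rw [pi_eq_sum_univ' x]
    simp [map_sum, mul_comm, Pi.single]
  rw [h1, Finset.sum_pow_eq_sum_piAntidiag]
  refine Finset.sum_congr rfl fun k _ => ?_
  simp only [mono, mul_pow, Finset.prod_mul_distrib]
  ring

lemma aux_dual_moment {d : ℕ} {σ τ : Measure (Fin d → ℝ)} (hσ : HasAllMoments σ)
    (hτ : HasAllMoments τ) (h : ∀ α, mMom σ α = mMom τ α)
    (L : StrongDual ℝ (Fin d → ℝ)) (n : ℕ) :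
    ∫ x, L x ^ n ∂σ = ∫ x, L x ^ n ∂τ := by
  simp only [fun x => aux_dual_pow L n x]
  rw [integral_finsetSum _ (fun k _ => (hσ k).const_mul _),
    integral_finsetSum _ (fun k _ => (hτ k).const_mul _)]
  refine Finset.sum_congr rfl fun k _ => ?_
  rw [integral_const_mul, integral_const_mul]
  congr 1
  exact h k

lemma aux_determinate {d : ℕ} {c : ℝ} (hc : 0 < c) {σ τ : Measure (Fin d → ℝ)}
    [IsFiniteMeasure σ] [IsFiniteMeasure τ] (hσ : HasAllMoments σ)
    (hτ : HasAllMoments τ) (h : ∀ α, mMom σ α = mMom τ α)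
    (hcσ : CoshInt c σ) (hcτ : CoshInt c τ) : σ = τ := by
  refine Measure.ext_of_charFunDual (funext fun L => ?_)
  set r := c / (‖L‖ + 1) with hr
  have hr0 : 0 < r := by positivity
  have hsub : ∀ (ρ : Measure (Fin d → ℝ)) [IsFiniteMeasure ρ], CoshInt c ρ →
      Set.Ioo (-r) r ⊆ interior (ProbabilityTheory.integrableExpSet L ρ) := by
    intro ρ _ hρ
    refine interior_maximal (fun s hs => ?_) isOpen_Ioo
    exact aux_integrableExp hc hρ L (abs_lt.2 hs)
  have han : ∀ (ρ : Measure (Fin d → ℝ)) [IsFiniteMeasure ρ], CoshInt c ρ →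
      AnalyticOnNhd ℂ (ProbabilityTheory.complexMGF L ρ) {z | z.re ∈ Set.Ioo (-r) r} := by
    intro ρ _ hρ z hz
    exact ProbabilityTheory.analyticAt_complexMGF (hsub ρ hρ hz)
  have hpre : IsPreconnected {z : ℂ | z.re ∈ Set.Ioo (-r) r} :=
    ((convex_Ioo (-r) r).linear_preimage Complex.reLm).isPreconnected
  have h0 : (0 : ℂ) ∈ {z : ℂ | z.re ∈ Set.Ioo (-r) r} := by simp [hr0]
  have hI : Complex.I ∈ {z : ℂ | z.re ∈ Set.Ioo (-r) r} := by simp [hr0]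
  have hder : ∀ (ρ : Measure (Fin d → ℝ)) [IsFiniteMeasure ρ], CoshInt c ρ → ∀ n : ℕ,
      iteratedDeriv n (ProbabilityTheory.complexMGF L ρ) 0 = ((∫ x, L x ^ n ∂ρ : ℝ) : ℂ) := by
    intro ρ _ hρ n
    rw [ProbabilityTheory.iteratedDeriv_complexMGF (hsub ρ hρ h0)]
    simp [← integral_complex_ofReal]
  have hev : ProbabilityTheory.complexMGF L σ =ᶠ[nhds 0] ProbabilityTheory.complexMGF L τ := by
    have e1 := (han σ hcσ 0 h0).hasFPowerSeriesAt
    have e2 := (han τ hcτ 0 h0).hasFPowerSeriesAt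
    have : ∀ n, iteratedDeriv n (ProbabilityTheory.complexMGF L σ) 0 =
        iteratedDeriv n (ProbabilityTheory.complexMGF L τ) 0 := by
      intro n
      rw [hder σ hcσ, hder τ hcτ, aux_dual_moment hσ hτ h]
    simp_rw [this] at e1
    filter_upwards [e1.eventually_hasSum_sub, e2.eventually_hasSum_sub] with z h1 h2
    exact h1.unique h2
  have hfin := (han σ hcσ).eqOn_of_preconnected_of_eventuallyEq (han τ hcτ) hpre h0 hev hI
  simp only [ProbabilityTheory.complexMGF] at hfin
  simpa only [charFunDual_apply, mul_comm] using hfin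

lemma aux_hjPos {d : ℕ} (μ ν : Measure (Fin d → ℝ)) [IsFiniteMeasure μ] [IsFiniteMeasure ν] :
    hjPos μ ν = μ - ν := by
  rw [hjPos, Measure.toJordanDecomposition_toSignedMeasure_sub]
  rfl

lemma aux_hjNeg {d : ℕ} (μ ν : Measure (Fin d → ℝ)) [IsFiniteMeasure μ] [IsFiniteMeasure ν] :
    hjNeg μ ν = ν - μ := by
  rw [hjNeg, Measure.toJordanDecomposition_toSignedMeasure_sub]
  rfl

lemma aux_psd {d : ℕ} {μ φ : Measure (Fin d → ℝ)} (hμ : HasAllMoments μ) (hle : φ ≤ μ) (n : ℕ) :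
    (momMat d n (mMom μ) - momMat d n (mMom φ)).PosSemidef := by
  have hφ : HasAllMoments φ := fun α => (hμ α).mono_measure hle
  have hmul : ∀ (a b : Fin d → ℕ) x, mono d (a + b) x = mono d a x * mono d b x := by
    intro a b x
    simp [mono, pow_add, Finset.prod_mul_distrib]
  refine Matrix.PosSemidef.of_dotProduct_mulVec_nonneg ?_ ?_
  · ext a b
    simp [momMat, add_comm]
  · intro v
    have hexp : ∀ x : Fin d → ℝ, (∑ a, v a * mono d a.1 x) ^ 2 =
        ∑ a, ∑ b, (v a * v b) * mono d (a.1 + b.1) x := by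
      intro x
      rw [sq, Finset.sum_mul_sum]
      refine Finset.sum_congr rfl fun a _ => Finset.sum_congr rfl fun b _ => ?_
      rw [hmul]
      ring
    have hI : ∀ ρ : Measure (Fin d → ℝ), HasAllMoments ρ →
        Integrable (fun x => (∑ a, v a * mono d a.1 x) ^ 2) ρ ∧
        ∫ x, (∑ a, v a * mono d a.1 x) ^ 2 ∂ρ = ∑ a, ∑ b, (v a * v b) * mMom ρ (a.1 + b.1) := by
      intro ρ hρ
      simp_rw [hexp]
      have hi : ∀ a b : {α : Fin d → ℕ // ∑ i, α i ≤ n},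
          Integrable (fun x => (v a * v b) * mono d (a.1 + b.1) x) ρ :=
        fun a b => (hρ _).const_mul _
      refine ⟨integrable_finsetSum _ fun a _ => integrable_finsetSum _ fun b _ => hi a b, ?_⟩
      rw [integral_finsetSum _ fun a _ => integrable_finsetSum _ fun b _ => hi a b]
      refine Finset.sum_congr rfl fun a _ => ?_
      rw [integral_finsetSum _ fun b _ => hi a b]
      refine Finset.sum_congr rfl fun b _ => ?_
      rw [integral_const_mul, mMom]
    have hineq : ∫ x, (∑ a, v a * mono d a.1 x) ^ 2 ∂φ ≤ ∫ x, (∑ a, v a * mono d a.1 x) ^ 2 ∂μ :=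
      integral_mono_measure hle (Filter.Eventually.of_forall fun x => sq_nonneg _) (hI μ hμ).1
    rw [(hI μ hμ).2, (hI φ hφ).2] at hineq
    have hq : star v ⬝ᵥ ((momMat d n (mMom μ) - momMat d n (mMom φ)).mulVec v) =
        ∑ a, ∑ b, (v a * v b) * mMom μ (a.1 + b.1) -
          ∑ a, ∑ b, (v a * v b) * mMom φ (a.1 + b.1) := by
      simp only [dotProduct, Matrix.mulVec, Matrix.sub_apply, momMat, Finset.mul_sum,
        ← Finset.sum_sub_distrib, Pi.star_apply, star_trivial]
      refine Finset.sum_congr rfl fun a _ => Finset.sum_congr rfl fun b _ => ?_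
      ring
    rw [hq]
    linarith

/-- Any feasible pair satisfies `φp + ν = φm + μ`. -/
lemma aux_feasible {d : ℕ} {μ ν φp φm : Measure (Fin d → ℝ)}
    [IsFiniteMeasure μ] [IsFiniteMeasure ν] [IsFiniteMeasure φp] [IsFiniteMeasure φm]
    (hA : Assumption1 μ ν) (hp : HasAllMoments φp) (hm : HasAllMoments φm)
    (h : ∀ α : Fin d → ℕ, mMom φp α - mMom φm α = mMom μ α - mMom ν α)
    (h1 : ∀ n : ℕ, (momMat d n (mMom μ) - momMat d n (mMom φp)).PosSemidef)
    (h2 : ∀ n : ℕ, (momMat d n (mMom ν) - momMat d n (mMom φm)).PosSemidef) :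
    φp + ν = φm + μ := by
  obtain ⟨hμ, hν, c, hc, hcμ, hcν⟩ := hA
  have kμ := aux_coshInt_of_exp hc hcμ
  have kν := aux_coshInt_of_exp hc hcν
  have kp := aux_coshInt_of_le hμ hp h1 kμ
  have km := aux_coshInt_of_le hν hm h2 kν
  refine aux_determinate hc (fun α => (hp α).add_measure (hν α))
    (fun α => (hm α).add_measure (hμ α)) (fun α => ?_)
    (fun i => (kp i).add_measure (kν i)) (fun i => (km i).add_measure (kμ i))
  have := h α
  rw [mMom, mMom, integral_add_measure (hp α) (hν α), integral_add_measure (hm α) (hμ α)]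
  simp only [mMom] at this
  linarith

lemma aux_le {d : ℕ} {μ ν φp φm : Measure (Fin d → ℝ)}
    [IsFiniteMeasure μ] [IsFiniteMeasure ν] (h : φp + ν = φm + μ) :
    μ - ν ≤ φp ∧ ν - μ ≤ φm := by
  constructor
  · refine Measure.sub_le_of_le_add ?_
    rw [h]
    exact Measure.le_add_left le_rfl
  · refine Measure.sub_le_of_le_add ?_
    rw [← h]
    exact Measure.le_add_left le_rfl

lemma aux_eq_of_le {d : ℕ} {α β : Measure (Fin d → ℝ)} [IsFiniteMeasure α] [IsFiniteMeasure β]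
    (h : α ≤ β) (hu : β Set.univ ≤ α Set.univ) : β = α := by
  exact (Measure.eq_of_le_of_measure_univ_eq h (le_antisymm (h _) hu)).symm

/-- Under Assumption 1, the infimum of `φ⁺(ℝ^d) + φ⁻(ℝ^d)` over pairs of finite
positive measures with all moments finite, matching moments `∫x^α dφ⁺ - ∫x^α dφ⁻ =
∫x^α dμ - ∫x^α dν` for all `α`, and moment-matrix dominations for all `n`, equals
`‖μ - ν‖_TV`, attained uniquely at the Hahn–Jordan decomposition of `μ - ν`. -/
theorem tv_eq_inf_moment_constraints (d : ℕ) (μ ν : Measure (Fin d → ℝ))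
    [IsFiniteMeasure μ] [IsFiniteMeasure ν] (hA : Assumption1 μ ν) :
    IsLeast {r : ℝ≥0∞ | ∃ φp φm : Measure (Fin d → ℝ),
        IsFiniteMeasure φp ∧ IsFiniteMeasure φm ∧
        HasAllMoments φp ∧ HasAllMoments φm ∧
        (∀ α : Fin d → ℕ, mMom φp α - mMom φm α = mMom μ α - mMom ν α) ∧
        (∀ n : ℕ, (momMat d n (mMom μ) - momMat d n (mMom φp)).PosSemidef) ∧
        (∀ n : ℕ, (momMat d n (mMom ν) - momMat d n (mMom φm)).PosSemidef) ∧
        r = φp Set.univ + φm Set.univ}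
      (hjPos μ ν Set.univ + hjNeg μ ν Set.univ) ∧
    (∀ φp φm : Measure (Fin d → ℝ), IsFiniteMeasure φp → IsFiniteMeasure φm →
      HasAllMoments φp → HasAllMoments φm →
      (∀ α : Fin d → ℕ, mMom φp α - mMom φm α = mMom μ α - mMom ν α) →
      (∀ n : ℕ, (momMat d n (mMom μ) - momMat d n (mMom φp)).PosSemidef) →
      (∀ n : ℕ, (momMat d n (mMom ν) - momMat d n (mMom φm)).PosSemidef) →
      φp Set.univ + φm Set.univ = hjPos μ ν Set.univ + hjNeg μ ν Set.univ →
      φp = hjPos μ ν ∧ φm = hjNeg μ ν) := by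
  rw [aux_hjPos, aux_hjNeg]
  refine ⟨⟨?_, ?_⟩, ?_⟩
  · obtain ⟨hμ, hν, -⟩ := hA
    have hpm : HasAllMoments (μ - ν) := fun α => (hμ α).mono_measure Measure.sub_le
    have hmm : HasAllMoments (ν - μ) := fun α => (hν α).mono_measure Measure.sub_le
    refine ⟨μ - ν, ν - μ, inferInstance, inferInstance, hpm, hmm, fun α => ?_,
      fun n => aux_psd hμ Measure.sub_le n, fun n => aux_psd hν Measure.sub_le n, rfl⟩
    have hkey : (μ - ν) + ν = (ν - μ) + μ := by
      have hs := Measure.sub_toSignedMeasure_eq_toSignedMeasure_sub (μ := μ) (ν := ν)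
      ext s hms
      have hs' := congrArg (fun t => t s) hs
      simp only [VectorMeasure.sub_apply, Measure.toSignedMeasure_apply_measurable hms] at hs'
      rw [← ENNReal.toReal_eq_toReal_iff' (measure_ne_top _ _) (measure_ne_top _ _)]
      change (μ - ν + ν).real s = (ν - μ + μ).real s
      rw [measureReal_add_apply, measureReal_add_apply]
      linarith
    have := congrArg (fun ρ => ∫ x, mono d α x ∂ρ) hkey
    rw [integral_add_measure (hpm α) (hν α), integral_add_measure (hmm α) (hμ α)] at this
    simp only [mMom]
    linarith
  · rintro r ⟨φp, φm, _, _, hp, hm, h, h1, h2, rfl⟩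
    obtain ⟨l1, l2⟩ := aux_le (aux_feasible hA hp hm h h1 h2)
    exact add_le_add (l1 _) (l2 _)
  · intro φp φm _ _ hp hm h h1 h2 hu
    obtain ⟨l1, l2⟩ := aux_le (aux_feasible hA hp hm h h1 h2)
    constructor
    · refine aux_eq_of_le l1 ?_
      have : φp Set.univ + (ν - μ) Set.univ ≤ (μ - ν) Set.univ + (ν - μ) Set.univ := by
        rw [← hu]
        gcongr
      exact (ENNReal.add_le_add_iff_right (measure_ne_top _ _)).1 this
    · refine aux_eq_of_le l2 ?_
      have : (μ - ν) Set.univ + φm Set.univ ≤ (μ - ν) Set.univ + (ν - μ) Set.univ := by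
        rw [← hu]
        gcongr
      exact (ENNReal.add_le_add_iff_left (measure_ne_top _ _)).1 this

end
end
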